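/- arXiv:1001.3270 — 2 statements merged into one kernel-verified Lean document; each statement's English description precedes it below -/
import Mathlib

section
/- Let M̄ be an admissible completion as a point set of (M,≪), endowed with the chr. topology. Then every singleton {(P,F)} ⊆ M̄ is closed; i.e., the chr. topology is T1. -/
open Filter Set Topology

variable {M : Type*}

/-- The chronological past `I⁻(p)` of a point. -/
def IPast (r : M → M → Prop) (p : M) : Set M := {q | r q p}

/-- The chronological future `I⁺(p)` of a point. -/
def IFut (r : M → M → Prop) (p : M) : Set M := {q | r p q}

/-- The chronological past `I⁻[S]` of a set. -/
def IPastS (r : M → M → Prop) (S : Set M) : Set M := ⋃ s ∈ S, IPast r s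

/-- The chronological future `I⁺[S]` of a set. -/
def IFutS (r : M → M → Prop) (S : Set M) : Set M := ⋃ s ∈ S, IFut r s

/-- A past set: `P = I⁻[P]`. -/
def IsPastSet (r : M → M → Prop) (P : Set M) : Prop := P = IPastS r P

/-- A future set: `F = I⁺[F]`. -/
def IsFutSet (r : M → M → Prop) (F : Set M) : Prop := F = IFutS r F

/-- An indecomposable past set (IP). -/
def IsIP (r : M → M → Prop) (P : Set M) : Prop :=
  P.Nonempty ∧ IsPastSet r P ∧
    ¬∃ P₁ P₂ : Set M, IsPastSet r P₁ ∧ IsPastSet r P₂ ∧ P₁ ⊂ P ∧ P₂ ⊂ P ∧ P = P₁ ∪ P₂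

/-- An indecomposable future set (IF). -/
def IsIF (r : M → M → Prop) (F : Set M) : Prop :=
  F.Nonempty ∧ IsFutSet r F ∧
    ¬∃ F₁ F₂ : Set M, IsFutSet r F₁ ∧ IsFutSet r F₂ ∧ F₁ ⊂ F ∧ F₂ ⊂ F ∧ F = F₁ ∪ F₂

/-- A terminal IP (TIP): an IP which is not of the form `I⁻(p)`. -/
def IsTIP (r : M → M → Prop) (P : Set M) : Prop := IsIP r P ∧ ∀ p : M, P ≠ IPast r p

/-- A terminal IF (TIF). -/
def IsTIF (r : M → M → Prop) (F : Set M) : Prop := IsIF r F ∧ ∀ p : M, F ≠ IFut r p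

/-- The common future `↑P`. -/
def commonFut (r : M → M → Prop) (P : Set M) : Set M := IFutS r {q | ∀ p ∈ P, r p q}

/-- The common past `↓F`. -/
def commonPast (r : M → M → Prop) (F : Set M) : Set M := IPastS r {q | ∀ p ∈ F, r q p}

/-- `P` is a maximal IP contained in `S`. -/
def MaxIPIn (r : M → M → Prop) (P S : Set M) : Prop :=
  IsIP r P ∧ P ⊆ S ∧ ∀ P', IsIP r P' → P' ⊆ S → P ⊆ P' → P = P'

/-- `F` is a maximal IF contained in `S`. -/
def MaxIFIn (r : M → M → Prop) (F S : Set M) : Prop :=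
  IsIF r F ∧ F ⊆ S ∧ ∀ F', IsIF r F' → F' ⊆ S → F ⊆ F' → F = F'

/-- The Szabados relation between (nonempty) indecomposable sets: `F` is a maximal IF
contained in `↑P` and `P` is a maximal IP contained in `↓F`. -/
def SRelNE (r : M → M → Prop) (P F : Set M) : Prop :=
  MaxIFIn r F (commonFut r P) ∧ MaxIPIn r P (commonPast r F)

/-- The full S-relation, allowing one empty component. -/
def SRel (r : M → M → Prop) (P F : Set M) : Prop :=
  SRelNE r P F ∨
    (F = ∅ ∧ IsIP r P ∧ ∀ F', IsIF r F' → ¬SRelNE r P F') ∨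
    (P = ∅ ∧ IsIF r F ∧ ∀ P', IsIP r P' → ¬SRelNE r P' F)

/-- The embedding `i(p) = (I⁻(p), I⁺(p))`. -/
def chrEmb (r : M → M → Prop) (p : M) : Set M × Set M := (IPast r p, IFut r p)

/-- The image `i(M)` inside the set of pairs. -/
def imgM (r : M → M → Prop) : Set (Set M × Set M) := Set.range (chrEmb r)

/-- An admissible completion as a point set. -/
structure IsAdmissibleCompletion (r : M → M → Prop) (Mb : Set (Set M × Set M)) : Prop where
  mem_point : ∀ p : M, chrEmb r p ∈ Mb
  complete_TIP : ∀ P : Set M, IsTIP r P → ∃ x ∈ Mb \ imgM r, x.1 = P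
  complete_TIF : ∀ F : Set M, IsTIF r F → ∃ x ∈ Mb \ imgM r, x.2 = F
  srel : ∀ x ∈ Mb, SRel r x.1 x.2

/-- The extended chronological relation `(P,F) ≪̄ (P',F') ↔ F ∩ P' ≠ ∅`. -/
def extChron (x y : Set M × Set M) : Prop := (x.2 ∩ y.1).Nonempty

/-- A chronology: a transitive and anti-reflexive binary relation. -/
def IsChronology (r : M → M → Prop) : Prop := Transitive r ∧ Irreflexive r

/-- A chronological set: a chronology with no isolates which is chronologically separable. -/
def IsChronologicalSet (r : M → M → Prop) : Prop :=
  IsChronology r ∧ (∀ x, ∃ y, r x y ∨ r y x) ∧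
    ∃ S : Set M, S.Countable ∧ ∀ x y, r x y → ∃ s ∈ S, r x s ∧ r s y
/-- The chronological future of a point of the completion, inside the completion,
with respect to the extended chronological relation. -/
def futIn (Mb : Set (Set M × Set M)) (x : ↥Mb) : Set ↥Mb :=
  {y | extChron (x : Set M × Set M) (y : Set M × Set M)}

/-- The chronological past of a point of the completion, inside the completion. -/
def pastIn (Mb : Set (Set M × Set M)) (x : ↥Mb) : Set ↥Mb :=
  {y | extChron (y : Set M × Set M) (x : Set M × Set M)}

/-- CEAT: the coarsest topology on the completion in which all the sets `I⁺((P,F))`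
and `I⁻((P,F))` are open. -/
def CEAT (Mb : Set (Set M × Set M)) : TopologicalSpace ↥Mb :=
  TopologicalSpace.generateFrom
    ({S | ∃ x : ↥Mb, S = futIn Mb x} ∪ {S | ∃ x : ↥Mb, S = pastIn Mb x})

/-- The set-theoretic inferior limit of a sequence of sets. -/
def setLI (A : ℕ → Set M) : Set M := {x | ∀ᶠ n in Filter.atTop, x ∈ A n}

/-- The set-theoretic superior limit of a sequence of sets. -/
def setLS (A : ℕ → Set M) : Set M := {x | ∃ᶠ n in Filter.atTop, x ∈ A n}

/-- The chronological limit operator (on pairs). -/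
def chrLim (r : M → M → Prop) (σ : ℕ → Set M × Set M) (x : Set M × Set M) : Prop :=
  (x.1 ≠ ∅ → x.1 ⊆ setLI (fun n => (σ n).1) ∧ MaxIPIn r x.1 (setLS fun n => (σ n).1)) ∧
  (x.2 ≠ ∅ → x.2 ⊆ setLI (fun n => (σ n).2) ∧ MaxIFIn r x.2 (setLS fun n => (σ n).2))

/-- The topology derived from a limit operator: closed sets are those containing all the
`L`-limits of their sequences. -/
def derivedTop {X : Type*} (L : (ℕ → X) → Set X)
    (hL : ∀ (σ : ℕ → X) (φ : ℕ → ℕ), StrictMono φ → L σ ⊆ L (σ ∘ φ)) :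
    TopologicalSpace X where
  IsOpen U := ∀ σ : ℕ → X, (∀ n, σ n ∈ Uᶜ) → L σ ⊆ Uᶜ
  isOpen_univ := by
    intro σ h
    simpa using h 0
  isOpen_inter := by
    intro U V hU hV σ hσ x hx
    have h : ∀ n, σ n ∈ Uᶜ ∨ σ n ∈ Vᶜ := by
      intro n
      have h' := hσ n
      rw [Set.compl_inter] at h'
      exact h'
    have hfreq : (∃ᶠ n in Filter.atTop, σ n ∈ Uᶜ) ∨ ∃ᶠ n in Filter.atTop, σ n ∈ Vᶜ :=
      Filter.frequently_or_distrib.mp (Filter.Frequently.of_forall h)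
    rw [Set.compl_inter]
    rcases hfreq with hf | hf
    · obtain ⟨φ, hφ, hmem⟩ := Filter.extraction_of_frequently_atTop hf
      exact Or.inl (hU (σ ∘ φ) hmem (hL σ φ hφ hx))
    · obtain ⟨φ, hφ, hmem⟩ := Filter.extraction_of_frequently_atTop hf
      exact Or.inr (hV (σ ∘ φ) hmem (hL σ φ hφ hx))
  isOpen_sUnion := by
    intro S hS σ hσ x hx
    intro hmem
    rcases hmem with ⟨U, hU, hxU⟩
    exact hS U hU σ (fun n h => hσ n ⟨U, hU, h⟩) hx hxU

lemma setLI_subseq {A : ℕ → Set M} {φ : ℕ → ℕ} (hφ : StrictMono φ) :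
    setLI A ⊆ setLI fun n => A (φ n) :=
  fun _ hx => hφ.tendsto_atTop.eventually hx

lemma setLS_subseq {A : ℕ → Set M} {φ : ℕ → ℕ} (hφ : StrictMono φ) :
    (setLS fun n => A (φ n)) ⊆ setLS A :=
  fun _ hx => hφ.tendsto_atTop.frequently hx

/-- The chronological limit operator on the completion. -/
def chrL (r : M → M → Prop) (Mb : Set (Set M × Set M)) (σ : ℕ → ↥Mb) : Set ↥Mb :=
  {x | chrLim r (fun n => ((σ n : Set M × Set M))) (x : Set M × Set M)}

lemma chrL_subseq (r : M → M → Prop) (Mb : Set (Set M × Set M)) :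
    ∀ (σ : ℕ → ↥Mb) (φ : ℕ → ℕ), StrictMono φ → chrL r Mb σ ⊆ chrL r Mb (σ ∘ φ) := by
  intro σ φ hφ x hx
  obtain ⟨h1, h2⟩ := hx
  constructor
  · intro hne
    obtain ⟨hli, hmax⟩ := h1 hne
    exact ⟨fun y hy => setLI_subseq hφ (hli hy), hmax.1,
      fun y hy => Filter.Eventually.frequently (setLI_subseq hφ (hli hy)),
      fun P' hP' hP'sub hsub => hmax.2.2 P' hP' (fun y hy => setLS_subseq hφ (hP'sub hy)) hsub⟩
  · intro hne
    obtain ⟨hli, hmax⟩ := h2 hne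
    exact ⟨fun y hy => setLI_subseq hφ (hli hy), hmax.1,
      fun y hy => Filter.Eventually.frequently (setLI_subseq hφ (hli hy)),
      fun F' hF' hF'sub hsub => hmax.2.2 F' hF' (fun y hy => setLS_subseq hφ (hF'sub hy)) hsub⟩

/-- The chronological topology on the completion. -/
def chrTop (r : M → M → Prop) (Mb : Set (Set M × Set M)) : TopologicalSpace ↥Mb :=
  derivedTop (chrL r Mb) (chrL_subseq r Mb)

/-- Admissibility condition (A1): chronological futures and pasts are open. -/
def CondA1 (Mb : Set (Set M × Set M)) (τ : TopologicalSpace ↥Mb) : Prop :=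
  ∀ x : ↥Mb, IsOpen[τ] (futIn Mb x) ∧ IsOpen[τ] (pastIn Mb x)

/-- Admissibility condition (A2). -/
def CondA2 (Mb : Set (Set M × Set M)) (τ : TopologicalSpace ↥Mb) : Prop :=
  (∀ (σ : ℕ → ↥Mb) (x : ↥Mb), Filter.Tendsto σ Filter.atTop (@nhds _ τ x) →
      (x : Set M × Set M).2 = ∅ →
      ∀ y : ↥Mb, (x : Set M × Set M).1 ⊆ (y : Set M × Set M).1 →
        (y : Set M × Set M).1 ⊆ setLI (fun n => ((σ n : Set M × Set M)).1) → y = x) ∧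
  (∀ (σ : ℕ → ↥Mb) (x : ↥Mb), Filter.Tendsto σ Filter.atTop (@nhds _ τ x) →
      (x : Set M × Set M).1 = ∅ →
      ∀ y : ↥Mb, (x : Set M × Set M).2 ⊆ (y : Set M × Set M).2 →
        (y : Set M × Set M).2 ⊆ setLI (fun n => ((σ n : Set M × Set M)).2) → y = x)

/-- Admissibility condition (A3): maximal coarseness among (A1)∧(A2) topologies. -/
def CondA3 (Mb : Set (Set M × Set M)) (τ : TopologicalSpace ↥Mb) : Prop :=
  ∀ τ' : TopologicalSpace ↥Mb, CondA1 Mb τ' → CondA2 Mb τ' → ¬(τ < τ')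

lemma IsIP.ne_empty {r : M → M → Prop} {P : Set M} (h : IsIP r P) : P ≠ ∅ := h.1.ne_empty

lemma IsIF.ne_empty {r : M → M → Prop} {F : Set M} (h : IsIF r F) : F ≠ ∅ := h.1.ne_empty

lemma SRel.isIP {r : M → M → Prop} {P F : Set M} (h : SRel r P F) (hP : P ≠ ∅) : IsIP r P := by
  rcases h with h | h | h
  exacts [h.2.1, h.2.1, absurd h.1 hP]

lemma SRel.isIF {r : M → M → Prop} {P F : Set M} (h : SRel r P F) (hF : F ≠ ∅) : IsIF r F := by
  rcases h with h | h | h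
  exacts [h.1.1, absurd h.1 hF, h.2.1]

lemma SRel.sRelNE {r : M → M → Prop} {P F : Set M} (h : SRel r P F) (hP : P ≠ ∅) (hF : F ≠ ∅) :
    SRelNE r P F := by
  rcases h with h | h | h
  exacts [h, absurd h.1 hF, absurd h.1 hP]

/-- An IP paired with `∅` is paired with nothing else. -/
lemma SRel.eq_empty_of_left {r : M → M → Prop} {P F : Set M} (h₀ : SRel r P ∅)
    (hP : P ≠ ∅) (h : SRel r P F) : F = ∅ := by
  by_contra hF
  rcases h₀ with h₀ | h₀ | h₀
  exacts [h₀.1.1.ne_empty rfl, h₀.2.2 F (h.isIF hF) (h.sRelNE hP hF), hP h₀.1]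

/-- An IF paired with `∅` is paired with nothing else. -/
lemma SRel.eq_empty_of_right {r : M → M → Prop} {P F : Set M} (h₀ : SRel r ∅ F)
    (hF : F ≠ ∅) (h : SRel r P F) : P = ∅ := by
  by_contra hP
  rcases h₀ with h₀ | h₀ | h₀
  exacts [h₀.2.1.ne_empty rfl, hF h₀.1, h₀.2.2 P (h.isIP hP) (h.sRelNE hP hF)]

lemma SRel.left_ne_empty_or_right_ne_empty {r : M → M → Prop} {P F : Set M} (h : SRel r P F) :
    P ≠ ∅ ∨ F ≠ ∅ := by
  rcases h with h | h | h
  exacts [.inl h.2.1.ne_empty, .inl h.2.1.ne_empty, .inr h.2.1.ne_empty]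

lemma setLS_const (A : Set M) : (setLS fun _ => A) = A := by
  ext x
  simp [setLS]

/-- Among S-related pairs, a constant sequence has at most one chr. limit. -/
lemma chrLim_const_eq {r : M → M → Prop} {x y : Set M × Set M} (hx : SRel r x.1 x.2)
    (hy : SRel r y.1 y.2) (h : chrLim r (fun _ => x) y) : y = x := by
  obtain ⟨P, F⟩ := x
  obtain ⟨P', F'⟩ := y
  simp only [chrLim, setLS_const] at h hx hy
  have hP : P' ≠ ∅ → P' = P := fun hne =>
    let hmax := (h.1 hne).2
    hmax.2.2 P (hx.isIP (hmax.1.1.mono hmax.2.1).ne_empty) subset_rfl hmax.2.1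
  have hF : F' ≠ ∅ → F' = F := fun hne =>
    let hmax := (h.2 hne).2
    hmax.2.2 F (hx.isIF (hmax.1.1.mono hmax.2.1).ne_empty) subset_rfl hmax.2.1
  by_cases hP' : P' = ∅
  · subst hP'
    have hF' : F' ≠ ∅ := hy.left_ne_empty_or_right_ne_empty.resolve_left (· rfl)
    obtain rfl := hF hF'
    rw [hy.eq_empty_of_right hF' hx]
  · obtain rfl := hP hP'
    by_cases hF' : F' = ∅
    · subst hF'
      rw [hy.eq_empty_of_left hP' hx]
    · rw [hF hF']

/-- **Proposition.** The chr. topology of an admissible completion as a point set is T1: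
every singleton is closed. -/
theorem chrTop_t1
    (r : M → M → Prop) (hr : IsChronology r)
    (Mb : Set (Set M × Set M)) (hMb : IsAdmissibleCompletion r Mb) :
    @T1Space ↥Mb (chrTop r Mb) := by
  let := chrTop r Mb
  refine ⟨fun x => ⟨?_⟩⟩
  intro σ hσ y hy
  rw [compl_compl] at hσ ⊢
  obtain rfl : σ = fun _ => x := funext hσ
  exact Subtype.ext (chrLim_const_eq (hMb.srel x x.2) (hMb.srel y y.2) hy)
end

section
/- Let M̄ be an admissible completion as a point set of (M,≪). Then the extended chronological relation ≪̄ on M̄ is transitive and anti-reflexive, and it is an admissible chronology: for every (P,F) ∈ M̄, {p ∈ M : (I⁻(p),I⁺(p)) ≪̄ (P,F)} = P and {q ∈ M : (P,F) ≪̄ (I⁻(q),I⁺(q))} = F; in particular, p ∈ P implies (I⁻(p),I⁺(p)) ≪̄ (P,F) and q ∈ F implies (P,F) ≪̄ (I⁻(q),I⁺(q)). -/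
open Filter Set Topology

variable {M : Type*}

theorem IsPastSet.mem_iff {r : M → M → Prop} {P : Set M} (h : IsPastSet r P) {p : M} :
    p ∈ P ↔ ∃ s ∈ P, r p s := by
  conv_lhs => rw [h]
  simp [IPastS, IPast]

theorem IsFutSet.mem_iff {r : M → M → Prop} {F : Set M} (h : IsFutSet r F) {q : M} :
    q ∈ F ↔ ∃ s ∈ F, r s q := by
  conv_lhs => rw [h]
  simp [IFutS, IFut]

theorem SRel.isPastSet {r : M → M → Prop} {P F : Set M} (h : SRel r P F) : IsPastSet r P := by
  rcases h with h | h | ⟨rfl, -⟩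
  · exact h.2.1.2.1
  · exact h.2.1.2.1
  · simp [IsPastSet, IPastS]

theorem SRel.isFutSet {r : M → M → Prop} {P F : Set M} (h : SRel r P F) : IsFutSet r F := by
  rcases h with h | ⟨rfl, -⟩ | h
  · exact h.1.1.2.1
  · simp [IsFutSet, IFutS]
  · exact h.2.1.2.1

/-- Every point of the past component chronologically precedes every point of the future one. -/
theorem SRel.rel_of_mem {r : M → M → Prop} (hr : IsChronology r) {P F : Set M} (h : SRel r P F)
    {p q : M} (hp : p ∈ P) (hq : q ∈ F) : r p q := by
  rcases h with h | ⟨rfl, -⟩ | ⟨rfl, -⟩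
  · have hq' := h.1.2.1 hq
    simp only [commonFut, IFutS, IFut, mem_iUnion, mem_ofPred_eq, exists_prop] at hq'
    obtain ⟨s, hs, hsq⟩ := hq'
    exact hr.1 (hs p hp) hsq
  · exact hq.elim
  · exact hp.elim

theorem extChron_chrEmb_left_iff {r : M → M → Prop} {x : Set M × Set M} (hx : SRel r x.1 x.2)
    {p : M} : extChron (chrEmb r p) x ↔ p ∈ x.1 := by
  rw [hx.isPastSet.mem_iff]
  simp [extChron, chrEmb, IFut, Set.Nonempty, and_comm]

theorem extChron_chrEmb_right_iff {r : M → M → Prop} {x : Set M × Set M} (hx : SRel r x.1 x.2)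
    {q : M} : extChron x (chrEmb r q) ↔ q ∈ x.2 := by
  rw [hx.isFutSet.mem_iff]
  simp [extChron, chrEmb, IPast, Set.Nonempty]

/-- **Theorem.** On an admissible completion as a point set, the extended chronological
relation `≪̄` is transitive and anti-reflexive, and it is an admissible chronology:
`{p ∈ M : i(p) ≪̄ (P,F)} = P` and `{q ∈ M : (P,F) ≪̄ i(q)} = F` for all `(P,F) ∈ M̄`;
in particular `p ∈ P` implies `i(p) ≪̄ (P,F)` and `q ∈ F` implies `(P,F) ≪̄ i(q)`. -/
theorem extChron_admissible
    (r : M → M → Prop) (hr : IsChronology r)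
    (Mb : Set (Set M × Set M)) (hMb : IsAdmissibleCompletion r Mb) :
    (∀ x y z : ↥Mb,
      extChron (x : Set M × Set M) (y : Set M × Set M) →
      extChron (y : Set M × Set M) (z : Set M × Set M) →
      extChron (x : Set M × Set M) (z : Set M × Set M)) ∧
    (∀ x : ↥Mb, ¬extChron (x : Set M × Set M) (x : Set M × Set M)) ∧
    (∀ x : ↥Mb,
      {p : M | extChron (chrEmb r p) (x : Set M × Set M)} = (x : Set M × Set M).1 ∧
      {q : M | extChron (x : Set M × Set M) (chrEmb r q)} = (x : Set M × Set M).2) ∧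
    (∀ x : ↥Mb,
      (∀ p ∈ (x : Set M × Set M).1, extChron (chrEmb r p) (x : Set M × Set M)) ∧
      (∀ q ∈ (x : Set M × Set M).2, extChron (x : Set M × Set M) (chrEmb r q))) := by
  refine ⟨?_, ?_, ?_, ?_⟩
  · rintro x y z ⟨q, hqx, hqy⟩ ⟨q', hqy', hqz⟩
    have hqq' := (hMb.srel y y.2).rel_of_mem hr hqy hqy'
    exact ⟨q, hqx, (hMb.srel z z.2).isPastSet.mem_iff.2 ⟨q', hqz, hqq'⟩⟩
  · rintro x ⟨q, hq, hq'⟩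
    exact hr.2 q ((hMb.srel x x.2).rel_of_mem hr hq' hq)
  · intro x
    exact ⟨Set.ext fun _ => extChron_chrEmb_left_iff (hMb.srel x x.2),
      Set.ext fun _ => extChron_chrEmb_right_iff (hMb.srel x x.2)⟩
  · intro x
    exact ⟨fun _ => (extChron_chrEmb_left_iff (hMb.srel x x.2)).2,
      fun _ => (extChron_chrEmb_right_iff (hMb.srel x x.2)).2⟩
end
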